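/- Let T be a town for scale r. Then diam(T) ≤ r and dist(T, V∖T) > r. Moreover, every vertex of the sprawl for scale r is at distance at most 2r from SPC(r). -/

import Mathlib

open SimpleGraph

universe u

variable {V : Type u}

/-- The length of a walk in a graph `G` with edge lengths `len`. -/
noncomputable def wlen {G : SimpleGraph V} (len : V → V → ℝ) {u v : V} (w : G.Walk u v) : ℝ :=
  (w.darts.map (fun e => len e.toProd.1 e.toProd.2)).sum

/-- A walk is a *shortest path* (w.r.t. the shortest-path metric `d`) if it is a
path whose total length equals the distance between its endpoints. -/
def IsShortestPath {G : SimpleGraph V} (len d : V → V → ℝ) {u v : V}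
    (w : G.Walk u v) : Prop :=
  w.IsPath ∧ wlen len w = d u v

/-- `d` is the shortest-path metric of the graph `G` with edge lengths `len`:
it is a lower bound on the length of every walk, and for every pair of vertices it
is attained by some path (a shortest path). -/
def IsShortestPathMetric (G : SimpleGraph V) (len d : V → V → ℝ) : Prop :=
  (∀ (u v : V) (w : G.Walk u v), d u v ≤ wlen len w) ∧
  (∀ u v : V, ∃ w : G.Walk u v, IsShortestPath len d w)

/-- The closed ball `B_r(v)` of radius `r` around `v` (w.r.t. `d`). -/
def cball (d : V → V → ℝ) (v : V) (r : ℝ) : Set V := {u | d u v ≤ r}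

/-- A *shortest path cover* for scale `r` (with parameter `c`): a set of hubs
hitting every shortest path of length in `(r, c*r/2]`. -/
def IsSPC (G : SimpleGraph V) (len d : V → V → ℝ) (c r : ℝ) (H : Set V) : Prop :=
  ∀ (u v : V) (w : G.Walk u v), IsShortestPath len d w →
    r < wlen len w → wlen len w ≤ c * r / 2 → ∃ h ∈ H, h ∈ w.support

/-- A minimal shortest path cover: no proper subset is a shortest path cover. -/
def IsMinimalSPC (G : SimpleGraph V) (len d : V → V → ℝ) (c r : ℝ) (H : Set V) : Prop :=
  IsSPC G len d c r H ∧ ∀ H' : Set V, H' ⊂ H → ¬ IsSPC G len d c r H'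

/-- `H` is locally `s`-sparse for scale `r`: every ball of radius `c*r/2` contains
at most `s` vertices of `H`. -/
def LocallySparse (d : V → V → ℝ) (c r : ℝ) (s : ℕ) (H : Set V) : Prop :=
  ∀ v : V, (H ∩ cball d v (c * r / 2)).ncard ≤ s

/-- Definition 1: the highway dimension of `G` is at most `k` if for every scale
`r > 0` and every ball of radius `c*r`, there are at most `k` vertices in the ball
hitting all shortest paths of length more than `r` that lie inside the ball. -/
def HighwayDimLE (G : SimpleGraph V) (len d : V → V → ℝ) (c : ℝ) (k : ℕ) : Prop :=
  ∀ r : ℝ, 0 < r → ∀ v : V, ∃ H : Set V, H ⊆ cball d v (c * r) ∧ H.ncard ≤ k ∧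
    ∀ (a b : V) (w : G.Walk a b), IsShortestPath len d w →
      (∀ x ∈ w.support, x ∈ cball d v (c * r)) → r < wlen len w →
      ∃ h ∈ H, h ∈ w.support

/-- A *town* for scale `r` w.r.t. the shortest path cover `H`: the set
`{u | dist(u,v) ≤ r}` for some vertex `v` with `dist(v, H) > 2*r`. -/
def IsTownForScale (d : V → V → ℝ) (H : Set V) (r : ℝ) (T : Set V) : Prop :=
  ∃ v : V, (∀ h ∈ H, 2 * r < d v h) ∧ T = {u | d u v ≤ r}

/-- The *sprawl* for scale `r`: the set of vertices belonging to no town for scale `r`. -/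
def sprawlForScale (d : V → V → ℝ) (H : Set V) (r : ℝ) : Set V :=
  {u | ∀ T : Set V, IsTownForScale d H r T → u ∉ T}

theorem wlen_append {G : SimpleGraph V} (len : V → V → ℝ) {u v w : V}
    (p : G.Walk u v) (q : G.Walk v w) :
    wlen len (p.append q) = wlen len p + wlen len q := by
  simp [wlen, Walk.darts_append]

theorem wlen_reverse {G : SimpleGraph V} {len : V → V → ℝ}
    (hlen_symm : ∀ u v : V, len u v = len v u) {u v : V} (p : G.Walk u v) :
    wlen len p.reverse = wlen len p := by
  simp only [wlen, Walk.darts_reverse, List.map_reverse, List.sum_reverse, List.map_map]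
  congr 1
  exact List.map_congr_left fun e _ => hlen_symm _ _

theorem wlen_nonneg {G : SimpleGraph V} {len : V → V → ℝ}
    (hlen_pos : ∀ u v : V, G.Adj u v → 0 < len u v) {u v : V} (p : G.Walk u v) :
    0 ≤ wlen len p := by
  refine List.sum_nonneg fun x hx => ?_
  obtain ⟨e, -, rfl⟩ := List.mem_map.1 hx
  exact (hlen_pos _ _ e.adj).le

namespace IsShortestPathMetric

variable {G : SimpleGraph V} {len d : V → V → ℝ}

theorem dist_self_le (hd : IsShortestPathMetric G len d) (u : V) : d u u ≤ 0 := by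
  simpa [wlen] using hd.1 u u Walk.nil

theorem dist_nonneg (hd : IsShortestPathMetric G len d)
    (hlen_pos : ∀ u v : V, G.Adj u v → 0 < len u v) (u v : V) : 0 ≤ d u v := by
  obtain ⟨w, -, hw⟩ := hd.2 u v
  exact hw ▸ wlen_nonneg hlen_pos w

theorem dist_comm (hd : IsShortestPathMetric G len d)
    (hlen_symm : ∀ u v : V, len u v = len v u) (u v : V) : d u v = d v u := by
  have key : ∀ a b : V, d a b ≤ d b a := fun a b => by
    obtain ⟨w, -, hw⟩ := hd.2 b a
    rw [← hw, ← wlen_reverse hlen_symm]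
    exact hd.1 _ _ _
  exact le_antisymm (key u v) (key v u)

theorem dist_triangle (hd : IsShortestPathMetric G len d) (u v w : V) :
    d u w ≤ d u v + d v w := by
  obtain ⟨p, -, hp⟩ := hd.2 u v
  obtain ⟨q, -, hq⟩ := hd.2 v w
  rw [← hp, ← hq, ← wlen_append]
  exact hd.1 _ _ _

/-- A pair of vertices whose distance lies in the range covered by a shortest path cover
has a hub between them. -/
theorem exists_hub_between (hd : IsShortestPathMetric G len d) {c r : ℝ} {H : Set V}
    (hH : IsSPC G len d c r H) {u v : V} (hr : r < d u v) (hc : d u v ≤ c * r / 2) :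
    ∃ h ∈ H, d u h + d h v ≤ d u v := by
  classical
  obtain ⟨w, hw⟩ := hd.2 u v
  obtain ⟨h, hh, hs⟩ := hH u v w hw (hw.2 ▸ hr) (hw.2 ▸ hc)
  refine ⟨h, hh, ?_⟩
  have hsplit := wlen_append len (w.takeUntil h hs) (w.dropUntil h hs)
  rw [w.take_spec hs, hw.2] at hsplit
  linarith [hd.1 _ _ (w.takeUntil h hs), hd.1 _ _ (w.dropUntil h hs)]

end IsShortestPathMetric

/-- Lemma 4 of the paper: a town `T` for scale `r` has
`diam(T) ≤ r` and `dist(T, V ∖ T) > r`, and every vertex of the sprawl for scale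
`r` is at distance at most `2*r` from the shortest path cover. -/
theorem statement2 {V : Type} [Fintype V] (G : SimpleGraph V) (len d : V → V → ℝ)
    (hlen_symm : ∀ u v : V, len u v = len v u)
    (hlen_pos : ∀ u v : V, G.Adj u v → 0 < len u v)
    (hmetric : IsShortestPathMetric G len d)
    (c : ℝ) (hc : 4 ≤ c) (r : ℝ) (hr : 0 < r)
    (H : Set V) (hH : IsSPC G len d c r H)
    (T : Set V) (hT : IsTownForScale d H r T) :
    (∀ x ∈ T, ∀ y ∈ T, d x y ≤ r) ∧
    (∀ x ∈ T, ∀ y ∈ Tᶜ, r < d x y) ∧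
    (∀ u ∈ sprawlForScale d H r, ∃ h ∈ H, d u h ≤ 2 * r) := by
  have hcr : 2 * r ≤ c * r / 2 := by nlinarith
  have comm := hmetric.dist_comm hlen_symm
  refine ⟨?_, ?_, ?_⟩
  · obtain ⟨v, hv, rfl⟩ := hT
    intro x (hx : d x v ≤ r) y (hy : d y v ≤ r)
    by_contra! hxy
    have hle : d x y ≤ 2 * r := by linarith [hmetric.dist_triangle x v y, comm v y]
    obtain ⟨h, hh, hb⟩ := hmetric.exists_hub_between hH hxy (hle.trans hcr)
    linarith [hv h hh, hmetric.dist_triangle v x h, hmetric.dist_triangle v y h,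
      comm v x, comm v y, comm h y]
  · obtain ⟨v, hv, rfl⟩ := hT
    intro x (hx : d x v ≤ r) y hy
    have hy : r < d y v := not_le.1 hy
    by_contra! hxy
    have hle : d v y ≤ 2 * r := by linarith [hmetric.dist_triangle v x y, comm v x]
    obtain ⟨h, hh, hb⟩ := hmetric.exists_hub_between hH (comm y v ▸ hy) (hle.trans hcr)
    linarith [hv h hh, hmetric.dist_nonneg hlen_pos h y]
  · intro u hu
    by_contra! hfar
    exact hu _ ⟨u, hfar, rfl⟩ ((hmetric.dist_self_le u).trans hr.le)
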